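/- arXiv:2412.13011 — 3 statements merged into one kernel-verified Lean document; each statement's English description precedes it below -/
import Mathlib

section
/- (Proposition 3(a)) Let H, H' be separable complex Hilbert spaces, F ⊆ D(H) and F' ⊆ D(H') trace-norm-closed sets of free states, and let Φ : T(H) → T(H') be a positive, trace-preserving (hence trace-norm contractive) linear map such that Φ(σ) ∈ F' for every σ ∈ F. Then for every density operator ρ on H, the lower semi-continuous generalized robustness satisfies R̲_{F'}(Φ(ρ)) ≤ R̲_F(ρ), i.e., R̲ is monotone under free operations. -/
open Filter Topology
open scoped ENNReal

/-- The generalized robustness `R_F(ρ)` of `ρ` with respect to the set `F` of free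
states (Definition 1): the infimum of `λ ≥ 0` such that `(ρ + λτ)/(1+λ) ∈ F` for some
density operator `τ ∈ D`; value `∞` if no such `λ` exists. -/
noncomputable def genRob {T : Type*} [AddCommGroup T] [Module ℂ T]
    (D F : Set T) (ρ : T) : ℝ≥0∞ :=
  sInf (ENNReal.ofReal ''
    {l : ℝ | 0 ≤ l ∧ ∃ τ ∈ D, (1 + (l : ℂ))⁻¹ • (ρ + (l : ℂ) • τ) ∈ F})

/-- The lower semi-continuous generalized robustness `R̲_F(ρ) = liminf_{ξ→ρ} R_F(ξ)`
(Definition 2): the infimum of `λ ≥ 0` such that there are sequences of density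
operators `ξₙ → ρ` (trace norm) and `τₙ ∈ D` with `(ξₙ + λτₙ)/(1+λ) ∈ F` for all `n`. -/
noncomputable def lscGenRob {T : Type*} [AddCommGroup T] [Module ℂ T]
    [TopologicalSpace T] (D F : Set T) (ρ : T) : ℝ≥0∞ :=
  sInf (ENNReal.ofReal ''
    {l : ℝ | 0 ≤ l ∧ ∃ ξ τ : ℕ → T, (∀ n, ξ n ∈ D) ∧ (∀ n, τ n ∈ D) ∧
      Tendsto ξ atTop (𝓝 ρ) ∧
      ∀ n, (1 + (l : ℂ))⁻¹ • (ξ n + (l : ℂ) • τ n) ∈ F})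

/-- Proposition 3(a): monotonicity of `R̲` under free operations.
`T`, `T'` model the trace-class operators on separable complex Hilbert spaces `H`,
`H'` with their trace norms; `pos`, `pos'` are the cones of positive operators and
`tr`, `tr'` the traces, so `D`, `D'` are the density operators.  If `F ⊆ D`,
`F' ⊆ D'` are trace-norm-closed sets of free states and `Φ` is a positive,
trace-preserving (hence trace-norm contractive) linear map with `Φ(F) ⊆ F'`, then
`R̲_{F'}(Φ(ρ)) ≤ R̲_F(ρ)` for every density operator `ρ`. -/
theorem stmt_5
    {T : Type*} [NormedAddCommGroup T] [NormedSpace ℂ T]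
    {T' : Type*} [NormedAddCommGroup T'] [NormedSpace ℂ T']
    (tr : T →ₗ[ℂ] ℂ) (tr' : T' →ₗ[ℂ] ℂ)
    (pos : Set T) (pos' : Set T')
    (D : Set T) (D' : Set T')
    (hD : D = {x | x ∈ pos ∧ tr x = 1})
    (hD' : D' = {x | x ∈ pos' ∧ tr' x = 1})
    (F : Set T) (F' : Set T') (hFD : F ⊆ D) (hF'D' : F' ⊆ D')
    (hFclosed : IsClosed F) (hF'closed : IsClosed F')
    (Φ : T →ₗ[ℂ] T')
    (hΦpos : ∀ x ∈ pos, Φ x ∈ pos')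
    (hΦtr : ∀ x : T, tr' (Φ x) = tr x)
    (hΦcontr : ∀ x : T, ‖Φ x‖ ≤ ‖x‖)
    (hΦfree : ∀ σ ∈ F, Φ σ ∈ F')
    (ρ : T) (hρ : ρ ∈ D) :
    lscGenRob D' F' (Φ ρ) ≤ lscGenRob D F ρ := by
  subst hD hD'
  have hmap : ∀ x ∈ {x | x ∈ pos ∧ tr x = 1}, Φ x ∈ {x | x ∈ pos' ∧ tr' x = 1} :=
    fun x hx => ⟨hΦpos x hx.1, (hΦtr x).trans hx.2⟩
  have hΦcont : Continuous Φ :=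
    AddMonoidHomClass.continuous_of_bound Φ 1 fun x => by simpa using hΦcontr x
  refine sInf_le_sInf (Set.image_mono ?_)
  rintro l ⟨hl, ξ, τ, hξ, hτ, hlim, hfree⟩
  refine ⟨hl, fun n => Φ (ξ n), fun n => Φ (τ n), fun n => hmap _ (hξ n),
    fun n => hmap _ (hτ n), (hΦcont.tendsto ρ).comp hlim, fun n => ?_⟩
  simpa only [map_smul, map_add] using hΦfree _ (hfree n)
end

section
/- (Proposition 3(b)) Let H be a separable complex Hilbert space and F ⊆ D(H) a set of free states that is closed in the trace norm topology (F not assumed convex). Then the lower semi-continuous generalized robustness is faithful: for every density operator ρ on H, R̲_F(ρ) = 0 if and only if ρ ∈ F. -/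
open Filter Topology
open scoped ENNReal

/-- Mixing `x` with `y` at weight `l` displaces `x` by at most `2 * l` when both have norm one. -/
theorem dist_mix_le {T : Type*} [NormedAddCommGroup T] [NormedSpace ℂ T]
    {x y : T} (hx : ‖x‖ = 1) (hy : ‖y‖ = 1) {l : ℝ} (hl : 0 ≤ l) :
    dist x ((1 + (l : ℂ))⁻¹ • (x + (l : ℂ) • y)) ≤ 2 * l := by
  have hnorm : ‖(1 + (l : ℂ))‖ = 1 + l := by
    rw [← Complex.ofReal_one, ← Complex.ofReal_add, Complex.norm_real,
      Real.norm_of_nonneg (by positivity)]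
  have hne : (1 + (l : ℂ)) ≠ 0 := by
    rw [← norm_pos_iff, hnorm]; positivity
  have hdiff : x - (1 + (l : ℂ))⁻¹ • (x + (l : ℂ) • y)
      = (1 + (l : ℂ))⁻¹ • (l : ℂ) • (x - y) := by
    rw [eq_inv_smul_iff₀ hne, smul_sub, smul_inv_smul₀ hne]
    module
  have hsub : ‖x - y‖ ≤ 2 := by
    linarith [norm_sub_le x y]
  rw [dist_eq_norm, hdiff, norm_smul, norm_smul, norm_inv, hnorm, Complex.norm_real,
    Real.norm_of_nonneg hl]
  calc (1 + l)⁻¹ * (l * ‖x - y‖) ≤ 1 * (l * 2) := by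
        gcongr
        exact inv_le_one_of_one_le₀ (by linarith)
    _ = 2 * l := by ring

/-- Proposition 3(b): faithfulness of `R̲`.
`T` models the trace-class operators on a separable complex Hilbert space `H` with the
trace norm; `D` is the set of density operators (each of trace norm one).  For a
trace-norm-closed, not necessarily convex, set `F ⊆ D` of free states and any density
operator `ρ`:  `R̲_F(ρ) = 0` if and only if `ρ ∈ F`. -/
theorem stmt_6
    {T : Type*} [NormedAddCommGroup T] [NormedSpace ℂ T]
    (D : Set T) (hDnorm : ∀ x ∈ D, ‖x‖ = 1)
    (F : Set T) (hFD : F ⊆ D) (hFclosed : IsClosed F)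
    (ρ : T) (hρ : ρ ∈ D) :
    lscGenRob D F ρ = 0 ↔ ρ ∈ F := by
  constructor
  · intro h
    rw [← hFclosed.closure_eq, Metric.mem_closure_iff]
    intro ε hε
    have hlt : lscGenRob D F ρ < ENNReal.ofReal (ε / 4) := by
      rw [h]; exact ENNReal.ofReal_pos.2 (by positivity)
    obtain ⟨_, ⟨l, ⟨hl, ξ, τ, hξ, hτ, hlim, hF⟩, rfl⟩, hlε⟩ := sInf_lt_iff.1 hlt
    have hlε' : l < ε / 4 := (ENNReal.ofReal_lt_ofReal_iff (by positivity)).1 hlε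
    obtain ⟨n, hn⟩ := (Metric.tendsto_nhds.1 hlim (ε / 2) (by positivity)).exists
    refine ⟨_, hF n, ?_⟩
    have hmix := dist_mix_le (hDnorm _ (hξ n)) (hDnorm _ (hτ n)) hl
    rw [dist_comm] at hn
    linarith [dist_triangle ρ (ξ n) ((1 + (l : ℂ))⁻¹ • (ξ n + (l : ℂ) • τ n))]
  · intro h
    refine le_antisymm (sInf_le ⟨0, ⟨le_rfl, fun _ => ρ, fun _ => ρ, fun _ => hρ, fun _ => hρ,
      tendsto_const_nhds, fun _ => ?_⟩, ENNReal.ofReal_zero⟩) zero_le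
    simpa using h
end

section
/- (Observable lower bound on robustness) Let H be a separable complex Hilbert space, F ⊆ D(H) a trace-norm-closed set of free states, ρ a density operator on H, and m ≥ 1 an integer. Then for every bounded positive operator X on H^{⊗m} satisfying 0 < tr[σ^{⊗m} X] ≤ 1 for all σ ∈ F, one has (1 + R̲_F(ρ))^m ≥ tr[ρ^{⊗m} X]. In particular, taking X = 1^{⊗m} − W/‖W‖_∞ for an m-copy resource witness W with tr[σ^{⊗m}W] ≠ ‖W‖_∞ for all σ ∈ F yields the experimentally accessible bound (1 + R̲_F(ρ))^m ≥ 1 − tr[ρ^{⊗m}W]/‖W‖_∞. -/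
open Filter Topology
open scoped ENNReal ComplexOrder

/-- The lower semi-continuous `m`-copy generalized robustness `R̲^{(m)}_F(ρ)`, where
`pow ξ = ξ^{⊗m}` and `Dm` is the set of density operators on `H^{⊗m}`. -/
noncomputable def lscGenRobM {T : Type*} [AddCommGroup T] [Module ℂ T]
    [TopologicalSpace T] {Tm : Type*} [AddCommGroup Tm] [Module ℂ Tm]
    (D : Set T) (Dm : Set Tm) (F : Set T) (pow : T → Tm) (ρ : T) : ℝ≥0∞ :=
  sInf (ENNReal.ofReal ''
    {l : ℝ | 0 ≤ l ∧ ∃ ξ : ℕ → T, ∃ τ : ℕ → Tm, ∃ σ : ℕ → T,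
      (∀ n, ξ n ∈ D) ∧ (∀ n, τ n ∈ Dm) ∧ (∀ n, σ n ∈ F) ∧
      Tendsto ξ atTop (𝓝 ρ) ∧
      ∀ n, (1 + (l : ℂ))⁻¹ • (pow (ξ n) + (l : ℂ) • τ n) = pow (σ n)})

/-- A functional nonnegative on the density operators and at most `1` on the powers of free
states is bounded at `pow ρ` by `1 + R̲^{(m)}_F(ρ)`. -/
theorem ofReal_re_le_one_add_lscGenRobM
    {T : Type*} [AddCommGroup T] [Module ℂ T] [TopologicalSpace T]
    {Tm : Type*} [AddCommGroup Tm] [Module ℂ Tm]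
    {D : Set T} {Dm : Set Tm} {F : Set T} {pow : T → Tm} (f : Tm →ₗ[ℂ] ℂ)
    (hf : Continuous fun ξ => f (pow ξ)) (hDm : ∀ τ ∈ Dm, 0 ≤ (f τ).re)
    (hF : ∀ σ ∈ F, (f (pow σ)).re ≤ 1) (ρ : T) :
    ENNReal.ofReal (f (pow ρ)).re ≤ 1 + lscGenRobM D Dm F pow ρ := by
  rw [add_comm, ← tsub_le_iff_right]
  refine le_sInf ?_
  rintro _ ⟨l, ⟨hl, ξ, τ, σ, -, hτ, hσ, hξ, h⟩, rfl⟩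
  rw [tsub_le_iff_right, ← ENNReal.ofReal_one, ← ENNReal.ofReal_add hl zero_le_one]
  refine ENNReal.ofReal_le_ofReal ?_
  refine le_of_tendsto ((Complex.continuous_re.comp hf).continuousAt.tendsto.comp hξ)
    (Eventually.of_forall fun n => ?_)
  have hne : (1 + (l : ℂ)) ≠ 0 := by
    have : (1 + l : ℝ) ≠ 0 := by positivity
    exact_mod_cast this
  have h' := congrArg (fun x => (f x).re) ((inv_smul_eq_iff₀ hne).1 (h n))
  simp only [map_add, map_smul, smul_eq_mul, Complex.add_re, Complex.mul_re, Complex.ofReal_re,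
    Complex.ofReal_im, Complex.one_re, Complex.one_im, Complex.add_im] at h'
  have h₁ := mul_nonneg hl (hDm _ (hτ n))
  have h₂ := mul_le_mul_of_nonneg_left (hF _ (hσ n)) (by positivity : 0 ≤ 1 + l)
  simp only [Function.comp_apply]
  linarith

/-- A continuous unital positive functional on a pre-C⋆-algebra has norm at most one on
self-adjoint elements. -/
theorem re_apply_le_norm_of_positive
    {B : Type*} [NormedRing B] [StarRing B] [CStarRing B] [NormedAlgebra ℂ B]
    [PartialOrder B] [StarOrderedRing B] (f : B →ₗ[ℂ] ℂ)
    (hf_pos : ∀ X : B, 0 ≤ X → 0 ≤ f X) (hf_one : f 1 = 1) {C : ℝ}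
    (hf_bound : ∀ X : B, ‖f X‖ ≤ C * ‖X‖) {W : B} (hW : IsSelfAdjoint W) :
    (f W).re ≤ ‖W‖ := by
  have hstar (t : ℝ) : star ((t : ℂ) • (1 : B)) = (t : ℂ) • (1 : B) := by
    have := map_real_smul (starAddEquiv (R := B)) continuous_star t 1
    simpa using this
  have hsq (V : B) (hV : IsSelfAdjoint V) : (f V).re ^ 2 ≤ (f (V ^ 2)).re := by
    set t := (f V).re with ht
    have hU : star (V - (t : ℂ) • 1) = V - (t : ℂ) • 1 := by
      rw [star_sub, hV.star_eq, hstar]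
    have h := hf_pos _ (star_mul_self_nonneg (V - (t : ℂ) • (1 : B)))
    have hexp : star (V - (t : ℂ) • (1 : B)) * (V - (t : ℂ) • 1)
        = V ^ 2 - (t : ℂ) • V - (t : ℂ) • V + (t : ℂ) • (t : ℂ) • (1 : B) := by
      rw [hU]
      simp only [sub_mul, mul_sub, smul_mul_assoc, mul_smul_comm, one_mul, mul_one, pow_two,
        smul_sub]
      abel
    rw [hexp] at h
    have h' := (Complex.le_def.1 h).1
    simp only [map_add, map_sub, map_smul, smul_eq_mul, hf_one, Complex.add_re, Complex.sub_re,
      Complex.mul_re, Complex.ofReal_re, Complex.ofReal_im, Complex.zero_re, mul_one] at h'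
    rw [← ht] at h'
    nlinarith
  by_contra! hlt
  have hpos : 0 < (f W).re := (norm_nonneg W).trans_lt hlt
  have hiter (k : ℕ) : (f W).re ^ 2 ^ k ≤ (f (W ^ 2 ^ k)).re := by
    induction k with
    | zero => simp
    | succ k ih =>
      calc (f W).re ^ 2 ^ (k + 1) = ((f W).re ^ 2 ^ k) ^ 2 := by rw [pow_succ, pow_mul]
        _ ≤ (f (W ^ 2 ^ k)).re ^ 2 := by gcongr
        _ ≤ (f ((W ^ 2 ^ k) ^ 2)).re := hsq _ (hW.pow _)
        _ = (f (W ^ 2 ^ (k + 1))).re := by rw [← pow_mul, ← pow_succ]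
  have hW0 : 0 < ‖W‖ := by
    refine norm_pos_iff.2 fun h => ?_
    simp [h] at hpos
  have hC : 0 ≤ C := by
    have := (norm_nonneg _).trans (hf_bound W)
    exact nonneg_of_mul_nonneg_left this hW0
  have hle (k : ℕ) : ((f W).re / ‖W‖) ^ 2 ^ k ≤ C := by
    rw [div_pow, div_le_iff₀ (by positivity)]
    calc (f W).re ^ 2 ^ k ≤ (f (W ^ 2 ^ k)).re := hiter k
      _ ≤ ‖f (W ^ 2 ^ k)‖ := Complex.re_le_norm _
      _ ≤ C * ‖W ^ 2 ^ k‖ := hf_bound _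
      _ ≤ C * ‖W‖ ^ 2 ^ k := by
        gcongr
        exact norm_pow_le' W (by positivity)
  have hlim := (tendsto_pow_atTop_atTop_of_one_lt ((one_lt_div hW0).2 hlt)).comp
    (tendsto_pow_atTop_atTop_of_one_lt (one_lt_two : (1 : ℕ) < 2))
  obtain ⟨k, hk⟩ := (hlim.eventually_gt_atTop C).exists
  exact (hle k).not_gt hk

/-- observable lower bounds to robustness.
`T`, `Tm` model the trace-class operators on a separable complex Hilbert space `H` and
on `H^{⊗m}` (trace norms); `pow ξ = ξ^{⊗m}`; `D`, `Dm` are the density operators;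
`F ⊆ D` is a trace-norm-closed set of free states.  `Bm` models the C⋆-algebra
`ℬ(H^{⊗m})` of bounded operators on `H^{⊗m}` with operator norm `‖·‖_∞` and Loewner
order, and `pair x X = tr[x X]` is the duality pairing; the identity
`1 + R̲^{(m)}_F = (1 + R̲_F)^m` is supplied as `hRm`.  Then:
(i) for every bounded positive operator `X` with `0 < tr[σ^{⊗m}X] ≤ 1` for all
`σ ∈ F`, one has `tr[ρ^{⊗m}X] ≤ (1 + R̲_F(ρ))^m`; and
(ii) for every `m`-copy resource witness `W` (bounded self-adjoint, `tr[ρ^{⊗m}W] < 0`,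
`tr[σ^{⊗m}W] ≥ 0` for all `σ ∈ F`) with `tr[σ^{⊗m}W] ≠ ‖W‖_∞` for all `σ ∈ F`,
one has the observable bound `1 - tr[ρ^{⊗m}W]/‖W‖_∞ ≤ (1 + R̲_F(ρ))^m`. -/
theorem stmt_12
    {T : Type*} [NormedAddCommGroup T] [NormedSpace ℂ T]
    {Tm : Type*} [NormedAddCommGroup Tm] [NormedSpace ℂ Tm]
    {Bm : Type*} [NormedRing Bm] [StarRing Bm] [CStarRing Bm]
    [NormedAlgebra ℂ Bm] [PartialOrder Bm] [StarOrderedRing Bm]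
    (D F : Set T) (hFD : F ⊆ D) (hFclosed : IsClosed F)
    (Dm : Set Tm) (m : ℕ) (hm : 1 ≤ m)
    (pow : T → Tm) (hpowD : ∀ σ ∈ D, pow σ ∈ Dm) (hpow_cont : Continuous pow)
    (hRm : ∀ ρ' : T, 1 + lscGenRobM D Dm F pow ρ' = (1 + lscGenRob D F ρ') ^ m)
    (pair : Tm →ₗ[ℂ] Bm →ₗ[ℂ] ℂ)
    (hpair_pos : ∀ τ ∈ Dm, ∀ X : Bm, 0 ≤ X → 0 ≤ pair τ X)
    (hpair_one : ∀ τ ∈ Dm, pair τ 1 = 1)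
    (hpair_bound : ∀ (x : Tm) (X : Bm), ‖pair x X‖ ≤ ‖x‖ * ‖X‖)
    (ρ : T) (hρ : ρ ∈ D) :
    (∀ X : Bm, 0 ≤ X →
      (∀ σ ∈ F, 0 < pair (pow σ) X ∧ pair (pow σ) X ≤ 1) →
      ENNReal.ofReal ((pair (pow ρ) X).re) ≤ (1 + lscGenRob D F ρ) ^ m) ∧
    (∀ W : Bm, IsSelfAdjoint W →
      pair (pow ρ) W < 0 →
      (∀ σ ∈ F, 0 ≤ pair (pow σ) W) →
      (∀ σ ∈ F, pair (pow σ) W ≠ (‖W‖ : ℂ)) →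
      ENNReal.ofReal (1 - (pair (pow ρ) W).re / ‖W‖) ≤ (1 + lscGenRob D F ρ) ^ m) := by
  have key (X : Bm) (hX : ∀ τ ∈ Dm, 0 ≤ (pair τ X).re)
      (hXF : ∀ σ ∈ F, (pair (pow σ) X).re ≤ 1) :
      ENNReal.ofReal (pair (pow ρ) X).re ≤ (1 + lscGenRob D F ρ) ^ m := by
    rw [← hRm]
    have hcont : Continuous (pair.flip X) :=
      AddMonoidHomClass.continuous_of_bound (pair.flip X) ‖X‖ fun x => by
        rw [mul_comm]
        exact hpair_bound x X
    exact ofReal_re_le_one_add_lscGenRobM (pair.flip X) (hcont.comp hpow_cont) hX hXF ρ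
  refine ⟨fun X hX hXF => key X (fun τ hτ => (Complex.le_def.1 (hpair_pos τ hτ X hX)).1)
    fun σ hσ => (Complex.le_def.1 (hXF σ hσ).2).1, fun W hW hWρ hWF _ => ?_⟩
  have hW0 : 0 < ‖W‖ := by
    refine norm_pos_iff.2 fun h => ?_
    simp [h] at hWρ
  have hre (τ : Tm) (hτ : τ ∈ Dm) :
      (pair τ (1 - ((‖W‖⁻¹ : ℝ) : ℂ) • W)).re = 1 - (pair τ W).re / ‖W‖ := by
    rw [map_sub, map_smul, hpair_one τ hτ, smul_eq_mul, Complex.sub_re, Complex.re_ofReal_mul,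
      Complex.one_re, div_eq_inv_mul]
  rw [← hre _ (hpowD ρ hρ)]
  refine key _ (fun τ hτ => ?_) fun σ hσ => ?_
  · rw [hre τ hτ, sub_nonneg, div_le_one hW0]
    exact re_apply_le_norm_of_positive (pair τ) (hpair_pos τ hτ) (hpair_one τ hτ)
      (hpair_bound τ) hW
  · rw [hre _ (hpowD σ (hFD hσ)), sub_le_self_iff]
    exact div_nonneg (Complex.le_def.1 (hWF σ hσ)).1 hW0.le
end
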